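/- Let T be a t-norm, V a finite vertex set, μ a fuzzy edge-membership function on V, and let e₁ = u₁v₁ and e₂ = u₂v₂ be two edges whose vertex sets {u₁,v₁} and {u₂,v₂} are disjoint (all four vertices distinct). Then fuzzy contractions with respect to T on e₁ and e₂ commute: contracting e₁ (merging v₁ into u₁) and then e₂ (merging v₂ into u₂) yields the same membership function on V as contracting e₂ first and then e₁; in particular both orders give μ''(u₁,u₂) = T(T(μ(u₁,u₂), μ(v₁,u₂)), T(μ(u₁,v₂), μ(v₁,v₂))) up to the commutativity and associativity of T, and agree on all other pairs. -/

import Mathlib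

open scoped Classical

/-- Fuzzy contraction of the edge `uv` (merging `v` into `u`) with respect to a
t-norm `T`: the merged vertex `u` gets membership `T (μ u x) (μ v x)` to each
`x ∉ {u, v}`, the vertex `v` is disconnected (all memberships `0`), and all other
memberships are unchanged. -/
noncomputable def contractT {V : Type*} (T : ℝ → ℝ → ℝ) (μ : V → V → ℝ) (u v : V) :
    V → V → ℝ := fun x y =>
  if x = v ∨ y = v then 0
  else if x = u ∧ y = u then 0
  else if x = u then T (μ u y) (μ v y)
  else if y = u then T (μ x u) (μ x v)
  else μ x y

/-- A binary operation that is commutative and associative on a set satisfies the medial law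
there. -/
theorem medial_of_comm_of_assoc_on {α : Type*} {s : Set α} {T : α → α → α}
    (hrange : ∀ a b, a ∈ s → b ∈ s → T a b ∈ s)
    (hcomm : ∀ a b, a ∈ s → b ∈ s → T a b = T b a)
    (hassoc : ∀ a b c, a ∈ s → b ∈ s → c ∈ s → T (T a b) c = T a (T b c))
    {a b c d : α} (ha : a ∈ s) (hb : b ∈ s) (hc : c ∈ s) (hd : d ∈ s) :
    T (T a b) (T c d) = T (T a c) (T b d) := by
  rw [hassoc a b _ ha hb (hrange c d hc hd), ← hassoc b c d hb hc hd, hcomm b c hb hc,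
    hassoc c b d hc hb hd, ← hassoc a c _ ha hc (hrange b d hb hd)]

/-- Fuzzy contractions with respect to a t-norm `T` on two
vertex-disjoint edges `e₁ = u₁v₁` and `e₂ = u₂v₂` commute: contracting `e₁`
(merging `v₁` into `u₁`) and then `e₂` (merging `v₂` into `u₂`) yields the same
membership function as the other order; in particular both orders give
`μ'' u₁ u₂ = T (T (μ u₁ u₂) (μ v₁ u₂)) (T (μ u₁ v₂) (μ v₁ v₂))`. -/
theorem contractT_comm_of_disjoint
    {V : Type*} [Fintype V]
    (T : ℝ → ℝ → ℝ)
    (hTrange : ∀ a b, a ∈ Set.Icc (0:ℝ) 1 → b ∈ Set.Icc (0:ℝ) 1 →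
      T a b ∈ Set.Icc (0:ℝ) 1)
    (hTcomm : ∀ a b, a ∈ Set.Icc (0:ℝ) 1 → b ∈ Set.Icc (0:ℝ) 1 → T a b = T b a)
    (hTassoc : ∀ a b c, a ∈ Set.Icc (0:ℝ) 1 → b ∈ Set.Icc (0:ℝ) 1 →
      c ∈ Set.Icc (0:ℝ) 1 → T (T a b) c = T a (T b c))
    (hTmono : ∀ a a' b b', a ∈ Set.Icc (0:ℝ) 1 → a' ∈ Set.Icc (0:ℝ) 1 →
      b ∈ Set.Icc (0:ℝ) 1 → b' ∈ Set.Icc (0:ℝ) 1 → a ≤ a' → b ≤ b' → T a b ≤ T a' b')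
    (hTone : ∀ a, a ∈ Set.Icc (0:ℝ) 1 → T a 1 = a)
    (μ : V → V → ℝ)
    (hrange : ∀ x y, μ x y ∈ Set.Icc (0:ℝ) 1)
    (hsymm : ∀ x y, μ x y = μ y x)
    (hdiag : ∀ x, μ x x = 0)
    (u₁ v₁ u₂ v₂ : V)
    (h12 : u₁ ≠ v₁) (h34 : u₂ ≠ v₂) (h13 : u₁ ≠ u₂) (h14 : u₁ ≠ v₂)
    (h23 : v₁ ≠ u₂) (h24 : v₁ ≠ v₂)
 :
    (∀ x y, contractT T (contractT T μ u₁ v₁) u₂ v₂ x y =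
            contractT T (contractT T μ u₂ v₂) u₁ v₁ x y) ∧
    contractT T (contractT T μ u₁ v₁) u₂ v₂ u₁ u₂ =
      T (T (μ u₁ u₂) (μ v₁ u₂)) (T (μ u₁ v₂) (μ v₁ v₂)) ∧
    contractT T (contractT T μ u₂ v₂) u₁ v₁ u₁ u₂ =
      T (T (μ u₁ u₂) (μ v₁ u₂)) (T (μ u₁ v₂) (μ v₁ v₂)) := by
  have hmedial (x y z w x' y' z' w' : V) :
      T (T (μ x y) (μ z w)) (T (μ x' y') (μ z' w')) =
        T (T (μ x y) (μ x' y')) (T (μ z w) (μ z' w')) :=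
    medial_of_comm_of_assoc_on hTrange hTcomm hTassoc
      (hrange _ _) (hrange _ _) (hrange _ _) (hrange _ _)
  have hzero : T 0 0 = 0 := by
    have h0 : (0 : ℝ) ∈ Set.Icc (0 : ℝ) 1 := by simp
    have h1 : (1 : ℝ) ∈ Set.Icc (0 : ℝ) 1 := by simp
    exact le_antisymm ((hTmono 0 0 0 1 h0 h0 h0 h1 le_rfl zero_le_one).trans_eq (hTone 0 h0))
      (hTrange 0 0 h0 h0).1
  have hcomm (x y : V) : contractT T (contractT T μ u₁ v₁) u₂ v₂ x y =
      contractT T (contractT T μ u₂ v₂) u₁ v₁ x y := by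
    by_cases h : x = u₁ ∧ y = u₂
    · obtain ⟨rfl, rfl⟩ := h
      simp [contractT, h12, h34, h13, h14, h23, h24, h13.symm, h14.symm, h23.symm,
        h24.symm, hmedial x y v₁ y]
    by_cases h' : x = u₂ ∧ y = u₁
    · obtain ⟨rfl, rfl⟩ := h'
      simp [contractT, h12, h34, h13, h14, h24, h23, h13.symm, h14.symm, h23.symm,
        h24.symm, hmedial x y x v₁]
    clear hTrange hTcomm hTassoc hTmono hTone hrange hsymm hdiag hmedial
    grind [contractT]
  have hval : contractT T (contractT T μ u₁ v₁) u₂ v₂ u₁ u₂ =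
      T (T (μ u₁ u₂) (μ v₁ u₂)) (T (μ u₁ v₂) (μ v₁ v₂)) := by
    simp [contractT, h12, h34, h13, h14, h13.symm, h14.symm, h23.symm, h24.symm]
  exact ⟨hcomm, hval, (hcomm u₁ u₂).symm.trans hval⟩
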